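/- Let B = {x ∈ ℝ³ : |x| < 1} be the open unit ball and d(x) = (1/4)(1 − |x|²). Let W : B → ℝ be twice continuously differentiable. Then for all indices k, r ∈ {1,2,3} and all x ∈ B, −∂_r( d^{−1} ∂_k( d² W ) )(x) = −d(x)^{−2} ∂_k( d³ ∂_r W )(x) − ( ∂_r d(x) ∂_k W(x) − ∂_k d(x) ∂_r W(x) ) + δ_{kr} W(x), where δ_{kr} is the Kronecker delta. -/

import Mathlib

open Set

noncomputable section

/-- Partial derivative `∂_i f` of a scalar function on `ℝ³` (realized as `Fin 3 → ℝ`). -/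
def pd (i : Fin 3) (f : (Fin 3 → ℝ) → ℝ) (x : Fin 3 → ℝ) : ℝ :=
  fderiv ℝ f x (Pi.single i 1)

/-- The open unit ball `B = {x ∈ ℝ³ : |x| < 1}` (Euclidean norm). -/
def ball3 : Set (Fin 3 → ℝ) := {x | ∑ i, x i ^ 2 < 1}

/-- The weight function `d(x) = (1/4)(1 − |x|²)`. -/
def dw (x : Fin 3 → ℝ) : ℝ := (1 - ∑ i, x i ^ 2) / 4

theorem isOpen_ball3 : IsOpen ball3 :=
  isOpen_lt (by fun_prop) continuous_const

theorem dw_pos {x : Fin 3 → ℝ} (hx : x ∈ ball3) : 0 < dw x := by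
  have h : ∑ i, x i ^ 2 < 1 := hx
  unfold dw
  linarith

theorem contDiff_dw : ContDiff ℝ 2 dw := by
  unfold dw
  fun_prop

theorem differentiable_dw : Differentiable ℝ dw :=
  contDiff_dw.differentiable (by norm_num)

theorem pd_congr {f g : (Fin 3 → ℝ) → ℝ} {x : Fin 3 → ℝ} (i : Fin 3)
    (h : ∀ y ∈ ball3, f y = g y) (hx : x ∈ ball3) : pd i f x = pd i g x := by
  have h' : f =ᶠ[nhds x] g :=
    Filter.eventually_of_mem (isOpen_ball3.mem_nhds hx) h
  simp only [pd, h'.fderiv_eq]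

theorem pd_add {f g : (Fin 3 → ℝ) → ℝ} {x : Fin 3 → ℝ} (i : Fin 3)
    (hf : DifferentiableAt ℝ f x) (hg : DifferentiableAt ℝ g x) :
    pd i (fun y => f y + g y) x = pd i f x + pd i g x := by
  simp [pd, fderiv_fun_add hf hg]

theorem pd_mul {f g : (Fin 3 → ℝ) → ℝ} {x : Fin 3 → ℝ} (i : Fin 3)
    (hf : DifferentiableAt ℝ f x) (hg : DifferentiableAt ℝ g x) :
    pd i (fun y => f y * g y) x = f x * pd i g x + pd i f x * g x := by
  simp [pd, fderiv_fun_mul hf hg, mul_comm]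

theorem pd_pow {f : (Fin 3 → ℝ) → ℝ} {x : Fin 3 → ℝ} (i : Fin 3) (n : ℕ)
    (hf : DifferentiableAt ℝ f x) :
    pd i (fun y => f y ^ n) x = n * f x ^ (n - 1) * pd i f x := by
  simp [pd, fderiv_fun_pow n hf]

theorem pd_dw (i : Fin 3) (x : Fin 3 → ℝ) : pd i dw x = -(x i / 2) := by
  have h : HasFDerivAt dw ((4 : ℝ)⁻¹ • -∑ j : Fin 3, (2 * x j) •
      (ContinuousLinearMap.proj j : (Fin 3 → ℝ) →L[ℝ] ℝ)) x := by
    have hs : HasFDerivAt (fun y : Fin 3 → ℝ => ∑ j, y j ^ 2)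
        (∑ j : Fin 3, (2 * x j) • (ContinuousLinearMap.proj j : (Fin 3 → ℝ) →L[ℝ] ℝ)) x :=
      HasFDerivAt.fun_sum fun j _ => by
        simpa using (hasFDerivAt_apply (𝕜 := ℝ) j x).pow 2
    refine ((hs.const_sub 1).const_mul (4 : ℝ)⁻¹).congr_of_eventuallyEq
      (Filter.Eventually.of_forall fun y => ?_)
    simp only [dw]
    ring
  rw [pd, h.fderiv]
  simp [Pi.single_apply]
  ring

theorem pd_pd_dw (i j : Fin 3) (x : Fin 3 → ℝ) :
    pd i (pd j dw) x = -((if j = i then (1 : ℝ) else 0) / 2) := by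
  have h : pd j dw = fun y => -(y j / 2) := funext (pd_dw j)
  have h' : HasFDerivAt (fun y : Fin 3 → ℝ => -(y j / 2))
      (-((2 : ℝ)⁻¹ • (ContinuousLinearMap.proj j : (Fin 3 → ℝ) →L[ℝ] ℝ))) x := by
    refine (((hasFDerivAt_apply (𝕜 := ℝ) j x).const_mul (2 : ℝ)⁻¹).neg).congr_of_eventuallyEq
      (Filter.Eventually.of_forall fun y => ?_)
    simp only [Pi.neg_apply]
    ring
  rw [h, pd, h'.fderiv]
  simp [Pi.single_apply]
  split_ifs <;> norm_num

theorem differentiable_pd_dw (j : Fin 3) : Differentiable ℝ (pd j dw) := by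
  rw [show pd j dw = fun y => -(y j / 2) from funext (pd_dw j)]
  fun_prop

theorem differentiableAt_fderiv {W : (Fin 3 → ℝ) → ℝ} {x : Fin 3 → ℝ}
    (h : ContDiffAt ℝ 2 W x) : DifferentiableAt ℝ (fderiv ℝ W) x :=
  (h.fderiv_right (m := 1) (by norm_num)).differentiableAt (by norm_num)

theorem differentiableAt_pd {W : (Fin 3 → ℝ) → ℝ} {x : Fin 3 → ℝ} (i : Fin 3)
    (h : ContDiffAt ℝ 2 W x) : DifferentiableAt ℝ (pd i W) x :=
  (differentiableAt_fderiv h).clm_apply (differentiableAt_const _)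

theorem pd_comm {W : (Fin 3 → ℝ) → ℝ} {x : Fin 3 → ℝ} (i j : Fin 3)
    (h : ContDiffAt ℝ 2 W x) : pd i (pd j W) x = pd j (pd i W) x := by
  have key (a b : Fin 3) : pd a (pd b W) x =
      fderiv ℝ (fderiv ℝ W) x (Pi.single a 1) (Pi.single b 1) := by
    have e : pd b W = fun y => fderiv ℝ W y (Pi.single b 1) := rfl
    rw [pd, e, fderiv_clm_apply (differentiableAt_fderiv h) (differentiableAt_const _)]
    simp
  rw [key, key]
  exact (h.isSymmSndFDerivAt (by simp)).eq _ _

/-- The first identity of Lemma `cor1`: for `W ∈ C²(B)`,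
`−∂_r(d^{−1} ∂_k(d² W)) = −d^{−2} ∂_k(d³ ∂_r W) − (∂_r d ∂_k W − ∂_k d ∂_r W) + δ_{kr} W`
on the open unit ball. -/
theorem stmt8 (W : (Fin 3 → ℝ) → ℝ) (hW : ContDiffOn ℝ 2 W ball3) :
    ∀ k r : Fin 3, ∀ x ∈ ball3,
      -(pd r (fun y => (dw y)⁻¹ * pd k (fun z => dw z ^ 2 * W z) y) x)
        = -(dw x ^ 2)⁻¹ * pd k (fun y => dw y ^ 3 * pd r W y) x
          - (pd r dw x * pd k W x - pd k dw x * pd r W x)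
          + (if k = r then (1 : ℝ) else 0) * W x := by
  intro k r x hx
  have hc {y} (hy : y ∈ ball3) : ContDiffAt ℝ 2 W y :=
    hW.contDiffAt (isOpen_ball3.mem_nhds hy)
  have hd {y} (hy : y ∈ ball3) : DifferentiableAt ℝ W y :=
    (hc hy).differentiableAt (by norm_num)
  have inner : ∀ y ∈ ball3, (dw y)⁻¹ * pd k (fun z => dw z ^ 2 * W z) y
      = 2 * (pd k dw y * W y) + dw y * pd k W y := by
    intro y hy
    have := (dw_pos hy).ne'
    rw [pd_mul k ((differentiable_dw y).fun_pow 2) (hd hy), pd_pow k 2 (differentiable_dw y)]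
    field_simp
    push_cast
    ring
  have hWk := differentiableAt_pd k (hc hx)
  have hdk := differentiable_pd_dw k x
  have hconst : pd r (fun _ => (2 : ℝ)) x = 0 := by simp [pd]
  rw [pd_congr r inner hx,
    pd_add r ((hdk.fun_mul (hd hx)).const_mul 2) ((differentiable_dw x).fun_mul hWk),
    pd_mul r (differentiableAt_const _) (hdk.fun_mul (hd hx)), hconst,
    pd_mul r hdk (hd hx), pd_mul r (differentiable_dw x) hWk, pd_pd_dw,
    pd_mul k ((differentiable_dw x).fun_pow 3) (differentiableAt_pd r (hc hx)),
    pd_pow k 3 (differentiable_dw x), pd_comm k r (hc hx)]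
  have := (dw_pos hx).ne'
  field_simp
  push_cast
  ring
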